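/- For every integer r ≥ 3 there exist real constants c, C > 0 and an integer M such that: every (r,r+1)-system (H,F) satisfies |F| ≤ C·|H|, and for every integer m ≥ M there exists an (r,r+1)-system (H,F) with |H| = m and |F| ≥ c·m. -/

import Mathlib

open SimpleGraph

/-- `G` is `K_r`-saturated: `G` contains no `r`-clique, but adding any missing edge
creates an `r`-clique. -/
def Ksat (r : ℕ) {V : Type*} (G : SimpleGraph V) : Prop :=
  G.CliqueFree r ∧ ∀ u v : V, u ≠ v → ¬ G.Adj u v →
    ¬ (G ⊔ fromEdgeSet {s(u, v)}).CliqueFree r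

/-- `G` is twin-free: distinct vertices have distinct neighbourhoods. -/
def TwinFree {V : Type*} (G : SimpleGraph V) : Prop :=
  ∀ u v : V, G.neighborSet u = G.neighborSet v → u = v

/-- Minimum degree of `G` is at least `t`. -/
def MinDegGe {V : Type*} (G : SimpleGraph V) (t : ℕ) : Prop :=
  ∀ v : V, t ≤ (G.neighborSet v).ncard

/-- Every pair of distinct twins has a common neighbour of degree exactly `t`. -/
def TwinCond {V : Type*} (G : SimpleGraph V) (t : ℕ) : Prop :=
  ∀ u v : V, u ≠ v → G.neighborSet u = G.neighborSet v →
    ∃ w : V, (G.neighborSet w).ncard = t ∧ G.Adj w u ∧ G.Adj w v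

/-- An `(r,t)`-system. -/
def IsRTSystem (r t : ℕ) {V : Type*} [DecidableEq V] (H : SimpleGraph V)
    (F : Finset (Finset V)) : Prop :=
  H.CliqueFree r ∧
  (∀ S ∈ F, S.card = t ∧
    (H.induce (S : Set V)).CliqueFree (r - 1) ∧
    ∀ v : V, v ∉ S → ¬ (H.induce ((insert v S : Finset V) : Set V)).CliqueFree (r - 1)) ∧
  (∀ S ∈ F, ∀ T ∈ F, S ≠ T → ¬ (H.induce ((S ∩ T : Finset V) : Set V)).CliqueFree (r - 2))

/-- A maximal `(r,t)`-system. -/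
def IsMaxRTSystem (r t : ℕ) {V : Type*} [DecidableEq V] (H : SimpleGraph V)
    (F : Finset (Finset V)) : Prop :=
  IsRTSystem r t H F ∧
  ∀ u v : V, u ≠ v → ¬ H.Adj u v →
    ¬ (H ⊔ fromEdgeSet {s(u, v)}).CliqueFree r ∨
    ∃ S ∈ F, ¬ (((H ⊔ fromEdgeSet {s(u, v)}).induce (S : Set V)).CliqueFree (r - 1))

/-- A `(3,t)`-system. -/
def Is3TSystem (t : ℕ) {V : Type*} [DecidableEq V] (H : SimpleGraph V)
    (F : Finset (Finset V)) : Prop :=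
  H.CliqueFree 3 ∧
  (∀ S ∈ F, S.card = t ∧
    (∀ u ∈ S, ∀ v ∈ S, ¬ H.Adj u v) ∧
    (∀ v : V, v ∉ S → ∃ u ∈ S, H.Adj v u)) ∧
  (∀ S ∈ F, ∀ T ∈ F, S ≠ T → (S ∩ T).Nonempty)

/-- A maximal `(3,t)`-system. -/
def IsMax3TSystem (t : ℕ) {V : Type*} [DecidableEq V] (H : SimpleGraph V)
    (F : Finset (Finset V)) : Prop :=
  Is3TSystem t H F ∧
  ∀ u v : V, u ≠ v → ¬ H.Adj u v →
    ¬ (H ⊔ fromEdgeSet {s(u, v)}).CliqueFree 3 ∨ ∃ S ∈ F, u ∈ S ∧ v ∈ S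

noncomputable def s3 (t m : ℕ) : ℕ :=
  sSup {a : ℕ | ∃ (H : SimpleGraph (Fin m)) (F : Finset (Finset (Fin m))),
    Is3TSystem t H F ∧ F.card = a}

noncomputable def ePrime (r t s : ℕ) : ℕ :=
  sInf {e : ℕ | ∃ (m : ℕ) (H : SimpleGraph (Fin m)) (F : Finset (Finset (Fin m))),
    IsMaxRTSystem r t H F ∧ F.card = s ∧ H.edgeSet.ncard = e}

noncomputable def e3min (t s : ℕ) : ℕ :=
  sInf {e : ℕ | ∃ (m : ℕ) (H : SimpleGraph (Fin m)) (F : Finset (Finset (Fin m))),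
    Is3TSystem t H F ∧ F.card = s ∧ H.edgeSet.ncard = e}

/-- Two dominating independent triples that share exactly one vertex are joined by a perfect
matching between their remaining vertices. -/
theorem cross_adj {V : Type*} {H : SimpleGraph V} {T : V → V → V → Prop} {W : V → Prop}
    (hW : ∀ x y z, T x y z → W x) (s12 : ∀ x y z, T x y z → T y x z)
    (s23 : ∀ x y z, T x y z → T x z y)
    (ind : ∀ x y z, T x y z → ¬ H.Adj x y)
    (ne : ∀ x y z, T x y z → x ≠ y)
    (dom : ∀ x y z v, T x y z → W v → v ≠ x → v ≠ y → v ≠ z →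
      H.Adj v x ∨ H.Adj v y ∨ H.Adj v z)
    {a b c y z : V} (h : T a b c) (h' : T a y z) (hyb : y ≠ b) (hyc : y ≠ c)
    (hzb : z ≠ b) (hzc : z ≠ c) :
    (H.Adj b z ∧ H.Adj c y) ∨ (H.Adj b y ∧ H.Adj c z) := by
  have e1 := dom _ _ _ b h' (hW _ _ _ (s12 _ _ _ h)) (ne _ _ _ h).symm hyb.symm hzb.symm
  have e2 := dom _ _ _ c h' (hW _ _ _ (s12 _ _ _ (s23 _ _ _ h))) (ne _ _ _ (s23 _ _ _ h)).symm
    hyc.symm hzc.symm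
  have e3 := dom _ _ _ y h (hW _ _ _ (s12 _ _ _ h')) (ne _ _ _ h').symm hyb hyc
  have e4 := dom _ _ _ z h (hW _ _ _ (s12 _ _ _ (s23 _ _ _ h'))) (ne _ _ _ (s23 _ _ _ h')).symm
    hzb hzc
  have i1 := ind _ _ _ h
  have i2 := ind _ _ _ (s23 _ _ _ h)
  have i3 := ind _ _ _ h'
  have i4 := ind _ _ _ (s23 _ _ _ h')
  simp only [H.adj_comm b a, H.adj_comm c a, H.adj_comm y a, H.adj_comm z a, H.adj_comm y b,
    H.adj_comm y c, H.adj_comm z b, H.adj_comm z c] at *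
  tauto

/-- The configuration of triples that arises from a triple all of whose vertices lie in many
triples is contradictory. -/
theorem no_linked_triples {V : Type*} {H : SimpleGraph V}
    {T : V → V → V → Prop} {W : V → Prop}
    (hW : ∀ x y z, T x y z → W x) (s12 : ∀ x y z, T x y z → T y x z)
    (s23 : ∀ x y z, T x y z → T x z y)
    (tri : ∀ u v w, W u → W v → W w → H.Adj u v → H.Adj v w → ¬ H.Adj u w)
    (ind : ∀ x y z, T x y z → ¬ H.Adj x y)
    (ne : ∀ x y z, T x y z → x ≠ y)
    (dom : ∀ x y z v, T x y z → W v → v ≠ x → v ≠ y → v ≠ z →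
      H.Adj v x ∨ H.Adj v y ∨ H.Adj v z)
    {a b c p q d e f g : V} (h : T a b c) (hpq : T a p q) (hd : T b d e) (hf : T c f g)
    (fb : ∀ X : List V, X.length ≤ 7 → ∃ y z, T b y z ∧ y ∉ X ∧ z ∉ X)
    (epb : ¬ H.Adj p b) (ebq : H.Adj b q) (ecp : H.Adj c p) (edp : H.Adj d p) (efq : H.Adj f q)
    (nd : d ∉ [a, b, c, p, q]) (ne' : e ∉ [a, b, c, p, q]) (nf : f ∉ [a, b, c, p, q, d, e]) :
    False := by
  have W2 : ∀ x y z, T x y z → W y := fun x y z h => hW _ _ _ (s12 _ _ _ h)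
  have W3 : ∀ x y z, T x y z → W z := fun x y z h => hW _ _ _ (s12 _ _ _ (s23 _ _ _ h))
  have tri' : ∀ {u v w}, W u → W v → W w → H.Adj v u → H.Adj v w → ¬ H.Adj u w :=
    fun hu hv hw h1 h2 => tri _ _ _ hu hv hw h1.symm h2
  simp only [List.mem_cons, List.not_mem_nil, or_false, not_or] at nd ne' nf
  have wa := hW _ _ _ h
  have wb := W2 _ _ _ h
  have wc := W3 _ _ _ h
  have wp := W2 _ _ _ hpq
  have wq := W3 _ _ _ hpq
  have wd := W2 _ _ _ hd
  have we := W3 _ _ _ hd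
  have wf := W2 _ _ _ hf
  have eda : H.Adj d a := by
    rcases dom _ _ _ d h wd nd.1 nd.2.1 nd.2.2.1 with h1 | h1 | h1
    · exact h1
    · exact (ind _ _ _ hd h1.symm).elim
    · exact (tri' wd wp wc edp.symm ecp.symm h1).elim
  have efa : H.Adj f a := by
    rcases dom _ _ _ f h wf nf.1 nf.2.1 nf.2.2.1 with h1 | h1 | h1
    · exact h1
    · exact (tri' wf wq wb efq.symm ebq.symm h1).elim
    · exact (ind _ _ _ hf h1.symm).elim
  have efe : H.Adj f e := by
    rcases dom _ _ _ f hd wf nf.2.1 nf.2.2.2.2.2.1 nf.2.2.2.2.2.2 with h1 | h1 | h1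
    · exact (tri' wf wq wb efq.symm ebq.symm h1).elim
    · exact (tri' wf wa wd efa.symm eda.symm h1).elim
    · exact h1
  have eep : H.Adj e p := by
    rcases dom _ _ _ e hpq we ne'.1 ne'.2.2.2.1 ne'.2.2.2.2 with h1 | h1 | h1
    · exact (tri' we wf wa efe efa h1).elim
    · exact h1
    · exact (tri' we wf wq efe efq h1).elim
  obtain ⟨d', e', hd', hn⟩ : ∃ d' e', T b d' e' ∧ H.Adj d e' ∧ H.Adj e d' ∧ p ≠ d' ∧ p ≠ e' := by
    obtain ⟨y, z, hT, hy, hz⟩ := fb [d, e, p] (by simp)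
    simp only [List.mem_cons, List.not_mem_nil, or_false, not_or] at hy hz
    rcases cross_adj hW s12 s23 ind ne dom hd hT hy.1 hy.2.1 hz.1 hz.2.1 with h1 | h1
    · exact ⟨y, z, hT, h1.1, h1.2, Ne.symm hy.2.2, Ne.symm hz.2.2⟩
    · exact ⟨z, y, s23 _ _ _ hT, h1.1, h1.2, Ne.symm hz.2.2, Ne.symm hy.2.2⟩
  have hpb : p ≠ b := by
    rintro rfl
    exact ind _ _ _ (s12 _ _ _ (s23 _ _ _ (s12 _ _ _ h))) ecp
  rcases dom _ _ _ p hd' wp hpb hn.2.2.1 hn.2.2.2 with h1 | h1 | h1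
  · exact epb h1
  · exact tri' (W2 _ _ _ hd') we wp hn.2.1 eep h1.symm
  · exact tri' (W3 _ _ _ hd') wd wp hn.1 edp h1.symm

/-- In a triangle-free graph, a maximal independent triple cannot have all three of its vertices
in many such triples. -/
theorem exists_vertex_not_fresh {V : Type*} {H : SimpleGraph V}
    {T : V → V → V → Prop} {W : V → Prop}
    (hW : ∀ x y z, T x y z → W x) (s12 : ∀ x y z, T x y z → T y x z)
    (s23 : ∀ x y z, T x y z → T x z y)
    (tri : ∀ u v w, W u → W v → W w → H.Adj u v → H.Adj v w → ¬ H.Adj u w)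
    (ind : ∀ x y z, T x y z → ¬ H.Adj x y)
    (ne : ∀ x y z, T x y z → x ≠ y)
    (dom : ∀ x y z v, T x y z → W v → v ≠ x → v ≠ y → v ≠ z →
      H.Adj v x ∨ H.Adj v y ∨ H.Adj v z)
    {a b c : V} (h : T a b c)
    (fa : ∀ X : List V, X.length ≤ 7 → ∃ y z, T a y z ∧ y ∉ X ∧ z ∉ X)
    (fb : ∀ X : List V, X.length ≤ 7 → ∃ y z, T b y z ∧ y ∉ X ∧ z ∉ X)
    (fc : ∀ X : List V, X.length ≤ 7 → ∃ y z, T c y z ∧ y ∉ X ∧ z ∉ X) : False := by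
  have W2 : ∀ x y z, T x y z → W y := fun x y z h => hW _ _ _ (s12 _ _ _ h)
  have W3 : ∀ x y z, T x y z → W z := fun x y z h => hW _ _ _ (s12 _ _ _ (s23 _ _ _ h))
  have fresh : ∀ {a b c : V}, T a b c →
      (∀ X : List V, X.length ≤ 7 → ∃ y z, T a y z ∧ y ∉ X ∧ z ∉ X) →
      ∀ X : List V, X.length ≤ 7 → b ∈ X → c ∈ X →
        ∃ y z, T a y z ∧ y ∉ X ∧ z ∉ X ∧ H.Adj b z ∧ H.Adj c y := by
    intro a b c h fa X hX hb hc
    obtain ⟨y, z, hT, hy, hz⟩ := fa X hX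
    rcases cross_adj hW s12 s23 ind ne dom h hT (ne_of_mem_of_not_mem hb hy).symm
      (ne_of_mem_of_not_mem hc hy).symm (ne_of_mem_of_not_mem hb hz).symm
      (ne_of_mem_of_not_mem hc hz).symm
      with h1 | h1
    · exact ⟨y, z, hT, hy, hz, h1⟩
    · exact ⟨z, y, s23 _ _ _ hT, hz, hy, h1⟩
  have crossed : ∀ {y z y' z' : V}, T a y z → T a y' z' → y' ≠ y → y' ≠ z → z' ≠ y → z' ≠ z →
      H.Adj c y → H.Adj c y' → H.Adj y z' ∧ H.Adj z y' := by
    intro y z y' z' h1 h2 n1 n2 n3 n4 e1 e2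
    rcases cross_adj hW s12 s23 ind ne dom h1 h2 n1 n2 n3 n4 with h3 | h3
    · exact h3
    · exact (tri _ _ _ (W3 _ _ _ h) (W2 _ _ _ h1) (W2 _ _ _ h2) e1 h3.1 e2).elim
  obtain ⟨b2, c2, h2, hb2, hc2, eb2, ec2⟩ := fresh h fa [a, b, c] (by simp) (by simp) (by simp)
  obtain ⟨b3, c3, h3, hb3, hc3, eb3, ec3⟩ := fresh h fa [a, b, c, b2, c2]
    (by simp) (by simp) (by simp)
  simp only [List.mem_cons, List.not_mem_nil, or_false, not_or] at hb2 hc2 hb3 hc3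
  have x23 := crossed h2 h3 (by tauto) (by tauto) (by tauto) (by tauto) ec2 ec3
  have nbb : ¬ H.Adj b2 b :=
    fun h' => tri _ _ _ (W3 _ _ _ h3) (W2 _ _ _ h2) (W2 _ _ _ h) x23.1.symm h' eb3.symm
  have ncc : ¬ H.Adj c2 c :=
    fun h' => tri _ _ _ (W2 _ _ _ h3) (W3 _ _ _ h2) (W3 _ _ _ h) x23.2.symm h' ec3.symm
  obtain ⟨d, e, hd, nd, ne', edp⟩ : ∃ d e, T b d e ∧ d ∉ [a, b, c, b2, c2] ∧
      e ∉ [a, b, c, b2, c2] ∧ H.Adj d b2 := by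
    obtain ⟨y, z, hT, hy, hz⟩ := fb [a, b, c, b2, c2] (by simp)
    rcases dom _ _ _ b2 hT (W2 _ _ _ h2) (by tauto)
      (by rintro rfl; simp at hy) (by rintro rfl; simp at hz) with h1 | h1 | h1
    · exact (nbb h1).elim
    · exact ⟨y, z, hT, hy, hz, h1.symm⟩
    · exact ⟨z, y, s23 _ _ _ hT, hz, hy, h1.symm⟩
  obtain ⟨f, g, hf, nf, efq⟩ : ∃ f g, T c f g ∧ f ∉ [a, b, c, b2, c2, d, e] ∧ H.Adj f c2 := by
    obtain ⟨y, z, hT, hy, hz⟩ := fc [a, b, c, b2, c2, d, e] (by simp)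
    rcases dom _ _ _ c2 hT (W3 _ _ _ h2) (by tauto)
      (by rintro rfl; simp at hy) (by rintro rfl; simp at hz) with h1 | h1 | h1
    · exact (ncc h1).elim
    · exact ⟨y, z, hT, hy, h1.symm⟩
    · exact ⟨z, y, s23 _ _ _ hT, hz, h1.symm⟩
  exact no_linked_triples hW s12 s23 tri ind ne dom h h2 hd hf fb nbb eb2 ec2 edp efq nd ne' nf

/-- The vertices of `K` that are not adjacent to `v`. -/
noncomputable def missing {V : Type*} (H : SimpleGraph V) (K : Finset V) (v : V) : Finset V :=
  open Classical in K.filter fun k => ¬ H.Adj v k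

theorem mem_missing {V : Type*} {H : SimpleGraph V} {K : Finset V} {v k : V} :
    k ∈ missing H K v ↔ k ∈ K ∧ ¬ H.Adj v k := by
  simp [missing]

/-- `K` is an `(r - 2)`-clique and every member of `F` induces a maximal `K_{r-1}`-free subgraph
of the `K_r`-free graph `H`. -/
structure CliqueLink {V : Type*} [DecidableEq V] (r : ℕ) (H : SimpleGraph V) (K : Finset V)
    (F : Finset (Finset V)) : Prop where
  three_le : 3 ≤ r
  cliqueFree : H.CliqueFree r
  isNClique : H.IsNClique (r - 2) K
  not_isNClique : ∀ S ∈ F, ∀ Q ⊆ S, ¬ H.IsNClique (r - 1) Q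
  exists_isNClique : ∀ S ∈ F, ∀ v ∉ S, ∃ Q ⊆ insert v S, H.IsNClique (r - 1) Q

/-- The distinct vertices `x`, `y`, `z` extend `K` to a member of `F`. -/
def IsExtension {V : Type*} [DecidableEq V] (F : Finset (Finset V)) (K : Finset V) (x y z : V) :
    Prop :=
  x ≠ y ∧ x ≠ z ∧ y ≠ z ∧ x ∉ K ∧ y ∉ K ∧ z ∉ K ∧ {x, y, z} ∪ K ∈ F

theorem IsExtension.swap_left {V : Type*} [DecidableEq V] {F : Finset (Finset V)} {K : Finset V}
    {x y z : V} (h : IsExtension F K x y z) : IsExtension F K y x z := by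
  obtain ⟨h1, h2, h3, h4, h5, h6, h7⟩ := h
  exact ⟨h1.symm, h3, h2, h5, h4, h6, by rwa [Finset.insert_comm]⟩

theorem IsExtension.swap_right {V : Type*} [DecidableEq V] {F : Finset (Finset V)} {K : Finset V}
    {x y z : V} (h : IsExtension F K x y z) : IsExtension F K x z y := by
  obtain ⟨h1, h2, h3, h4, h5, h6, h7⟩ := h
  exact ⟨h2, h1, h3.symm, h4, h6, h5, by rwa [Finset.pair_comm]⟩

theorem exists_isClique_union {V : Type*} [DecidableEq V] {H : SimpleGraph V} {K Q : Finset V}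
    (hK : H.IsClique K) (hQ : H.IsClique Q) (hd : Disjoint Q K) :
    ∃ R ⊆ Q ∪ K, H.IsClique R ∧ R.card + (Q.biUnion (missing H K)).card = Q.card + K.card := by
  have hU : Q.biUnion (missing H K) ⊆ K :=
    Finset.biUnion_subset.2 fun q _ k hk => (mem_missing.1 hk).1
  have adj : ∀ q ∈ Q, ∀ k ∈ K \ Q.biUnion (missing H K), H.Adj q k := by
    intro q hq k hk
    rw [Finset.mem_sdiff, Finset.mem_biUnion] at hk
    by_contra h
    exact hk.2 ⟨q, hq, mem_missing.2 ⟨hk.1, h⟩⟩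
  refine ⟨Q ∪ (K \ Q.biUnion (missing H K)),
    Finset.union_subset_union_right Finset.sdiff_subset, ?_, ?_⟩
  · intro u hu v hv huv
    simp only [Finset.coe_union, Set.mem_union, Finset.mem_coe] at hu hv
    rcases hu with hu | hu <;> rcases hv with hv | hv
    · exact hQ hu hv huv
    · exact adj u hu v hv
    · exact (adj v hv u hu).symm
    · exact hK (Finset.mem_sdiff.1 hu).1 (Finset.mem_sdiff.1 hv).1 huv
  · rw [Finset.card_union_of_disjoint (hd.mono_right Finset.sdiff_subset),
      Finset.card_sdiff_of_subset hU]
    have := Finset.card_le_card hU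
    omega

namespace CliqueLink

variable {V : Type*} [DecidableEq V] {r : ℕ} {H : SimpleGraph V} {K : Finset V}
  {F : Finset (Finset V)} {x y z : V}

theorem card_lt_of_isClique (hL : CliqueLink r H K F) {Q : Finset V} (hQ : H.IsClique Q)
    (hd : Disjoint Q K) : Q.card < (Q.biUnion (missing H K)).card + 2 := by
  obtain ⟨R, -, hR, hc⟩ := exists_isClique_union hL.isNClique.isClique hQ hd
  by_contra! h
  have h3 := hL.three_le
  have hK := hL.isNClique.card_eq
  obtain ⟨R', hR', hc'⟩ := Finset.exists_subset_card_eq (show r ≤ R.card by omega)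
  exact hL.cliqueFree R' ⟨hR.subset (by exact_mod_cast hR'), hc'⟩

theorem card_le_of_isClique (hL : CliqueLink r H K F) (h : IsExtension F K x y z)
    {Q : Finset V} (hQ : H.IsClique Q) (hs : Q ⊆ {x, y, z}) :
    Q.card ≤ (Q.biUnion (missing H K)).card := by
  obtain ⟨h1, h2, h3, h4, h5, h6, h7⟩ := h
  have hd : Disjoint Q K := by
    rw [Finset.disjoint_left]
    intro a ha hK
    have := hs ha
    simp only [Finset.mem_insert, Finset.mem_singleton] at this
    rcases this with rfl | rfl | rfl <;> contradiction
  obtain ⟨R, hRs, hR, hc⟩ := exists_isClique_union hL.isNClique.isClique hQ hd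
  by_contra! h
  have h3 := hL.three_le
  have hK := hL.isNClique.card_eq
  obtain ⟨R', hR', hc'⟩ := Finset.exists_subset_card_eq (show r - 1 ≤ R.card by omega)
  exact hL.not_isNClique _ h7 R' (hR'.trans (hRs.trans (Finset.union_subset_union_left hs)))
    ⟨hR.subset (by exact_mod_cast hR'), hc'⟩

theorem exists_dominating_clique (hL : CliqueLink r H K F) (h : IsExtension F K x y z) {v : V}
    (hK : v ∉ K) (hx : v ≠ x) (hy : v ≠ y) (hz : v ≠ z) :
    ∃ P ⊆ ({x, y, z} : Finset V), H.IsClique P ∧ (∀ p ∈ P, H.Adj v p) ∧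
      (missing H K v ∪ P.biUnion (missing H K)).card ≤ P.card := by
  obtain ⟨h1, h2, h3, h4, h5, h6, h7⟩ := h
  have hv : v ∉ ({x, y, z} ∪ K : Finset V) := by simp [*]
  obtain ⟨Q, hQs, hQ⟩ := hL.exists_isNClique _ h7 v hv
  have hvQ : v ∈ Q := by
    by_contra hvQ
    exact hL.not_isNClique _ h7 Q ((Finset.subset_insert_iff_of_notMem hvQ).1 hQs) hQ
  have hadj : ∀ p ∈ Q, ∀ q ∈ Q, p ≠ q → H.Adj p q := fun p hp q hq => hQ.isClique hp hq
  refine ⟨Q ∩ {x, y, z}, Finset.inter_subset_right,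
    hQ.isClique.subset (by exact_mod_cast Finset.inter_subset_left), ?_, ?_⟩
  · intro p hp
    refine hadj v hvQ p (Finset.mem_inter.1 hp).1 ?_
    rintro rfl
    exact hv (Finset.mem_union_left _ (Finset.mem_inter.1 hp).2)
  · have hsub : missing H K v ∪ (Q ∩ {x, y, z}).biUnion (missing H K) ⊆ K \ Q := by
      intro k hk
      rw [Finset.mem_union, Finset.mem_biUnion] at hk
      obtain ⟨p, hp, hpK, hk⟩ : ∃ p ∈ Q, p ∉ K ∧ k ∈ missing H K p := by
        rcases hk with hk | ⟨p, hp, hk⟩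
        · exact ⟨v, hvQ, hK, hk⟩
        · refine ⟨p, (Finset.mem_inter.1 hp).1, ?_, hk⟩
          have := (Finset.mem_inter.1 hp).2
          simp only [Finset.mem_insert, Finset.mem_singleton] at this
          rcases this with rfl | rfl | rfl <;> assumption
      rw [mem_missing] at hk
      rw [Finset.mem_sdiff]
      refine ⟨hk.1, fun hkQ => hk.2 (hadj p hp k hkQ ?_)⟩
      rintro rfl
      exact hpK hk.1
    have hQeq : Q = insert v ((Q ∩ {x, y, z}) ∪ (K ∩ Q)) := by
      ext a
      have := @hQs a
      simp only [Finset.mem_insert, Finset.mem_union, Finset.mem_inter,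
        Finset.mem_singleton] at this ⊢
      constructor
      · tauto
      · rintro (rfl | h | h)
        · exact hvQ
        · exact h.1
        · exact h.2
    have hc1 := Finset.card_insert_le v ((Q ∩ {x, y, z}) ∪ (K ∩ Q))
    have hc2 := Finset.card_union_le (Q ∩ {x, y, z}) (K ∩ Q)
    rw [← hQeq] at hc1
    have hc3 := Finset.card_sdiff_add_card_inter K Q
    have hc4 := Finset.card_le_card hsub
    have hc5 := hQ.card_eq
    have hc6 := hL.isNClique.card_eq
    have hc7 := hL.three_le
    omega

theorem missing_nonempty (hL : CliqueLink r H K F) (h : IsExtension F K x y z) :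
    (missing H K x).Nonempty := by
  have := hL.card_le_of_isClique h (Q := {x}) (by simp) (by simp)
  rw [← Finset.card_pos]
  simpa using this

theorem two_le_card (hL : CliqueLink r H K F) (h : IsExtension F K x y z) (hxy : H.Adj x y) :
    2 ≤ (missing H K x ∪ missing H K y).card := by
  have := hL.card_le_of_isClique h (Q := {x, y}) (by simp [hxy]) (by simp [Finset.insert_subset_iff])
  rwa [Finset.card_pair hxy.ne, Finset.biUnion_insert, Finset.singleton_biUnion] at this

theorem three_le_card (hL : CliqueLink r H K F) (h : IsExtension F K x y z) (hxy : H.Adj x y)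
    (hxz : H.Adj x z) (hyz : H.Adj y z) :
    3 ≤ (missing H K x ∪ (missing H K y ∪ missing H K z)).card := by
  have := hL.card_le_of_isClique h (Q := {x, y, z}) (by simp [hxy, hxz, hyz]) subset_rfl
  rwa [Finset.card_eq_three.2 ⟨x, y, z, h.1, h.2.1, h.2.2.1, rfl⟩, Finset.biUnion_insert,
    Finset.biUnion_insert, Finset.singleton_biUnion] at this

theorem eq_or_adj (hL : CliqueLink r H K F) {z' : V} (h : IsExtension F K x y z)
    (h' : IsExtension F K x y z') (hne : z ≠ z') : H.Adj z z' := by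
  obtain ⟨P, hP, hc, hadj, hcard⟩ := hL.exists_dominating_clique h (v := z') h'.2.2.2.2.2.1
    h'.2.1.symm h'.2.2.1.symm hne.symm
  by_cases hz : z ∈ P
  · exact (hadj z hz).symm
  have hz' : z' ∉ P := fun hz' => H.loopless.irrefl _ (hadj z' hz')
  have hsub : insert z' P ⊆ {x, y, z'} := by
    intro p hp
    rw [Finset.mem_insert] at hp
    rcases hp with rfl | hp
    · simp
    · have := hP hp
      simp only [Finset.mem_insert, Finset.mem_singleton] at this ⊢
      rcases this with h | h | rfl
      · exact Or.inl h
      · exact Or.inr (Or.inl h)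
      · exact absurd hp hz
  have hcl : H.IsClique (insert z' P : Finset V) := by
    rw [Finset.coe_insert]
    exact hc.insert fun b hb _ => hadj b hb
  have := hL.card_le_of_isClique h' hcl hsub
  rw [Finset.card_insert_of_notMem hz', Finset.biUnion_insert] at this
  omega

theorem card_le_of_not_adj (hL : CliqueLink r H K F) (h : IsExtension F K x y z) {v : V}
    (hK : v ∉ K) (hx : v ≠ x) (hy : v ≠ y) (hz : v ≠ z) (hne : (missing H K v).Nonempty)
    (hadj : ¬ H.Adj v x) :
    (missing H K v ∪ missing H K y).card ≤ 1 ∨ (missing H K v ∪ missing H K z).card ≤ 1 ∨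
      H.Adj y z ∧ (missing H K v ∪ (missing H K y ∪ missing H K z)).card ≤ 2 := by
  obtain ⟨P, hP, hc, hP', hcard⟩ := hL.exists_dominating_clique h hK hx hy hz
  have hxP : x ∉ P := fun hxP => hadj (hP' x hxP)
  have hPyz : P ⊆ {y, z} := (Finset.subset_insert_iff_of_notMem hxP).1 hP
  have hP0 : P ≠ ∅ := by
    rintro rfl
    simp only [Finset.biUnion_empty, Finset.union_empty, Finset.card_empty, Nat.le_zero,
      Finset.card_eq_zero] at hcard
    exact hne.ne_empty hcard
  have hPyz' : P = ∅ ∨ P = {z} ∨ P = {y} ∨ P = {y, z} := by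
    rw [← Finset.mem_powerset, Finset.powerset_insert] at hPyz
    simpa [or_assoc, @eq_comm _ _ P] using hPyz
  rcases hPyz' with rfl | rfl | rfl | rfl
  · exact absurd rfl hP0
  · right; left
    simpa using hcard
  · left
    simpa using hcard
  · right; right
    refine ⟨hc (by simp) (by simp) h.2.2.1, ?_⟩
    rwa [Finset.card_pair h.2.2.1, Finset.biUnion_insert, Finset.singleton_biUnion] at hcard

end CliqueLink

theorem eq_of_card_union_le_one {α : Type*} [DecidableEq α] {A B : Finset α} (hA : A.Nonempty)
    (hB : B.Nonempty) (h : (A ∪ B).card ≤ 1) : A = B ∧ A.card = 1 := by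
  have hA' : A = A ∪ B := Finset.eq_of_subset_of_card_le Finset.subset_union_left
    (h.trans hA.card_pos)
  have hB' : B = A ∪ B := Finset.eq_of_subset_of_card_le Finset.subset_union_right
    (h.trans hB.card_pos)
  refine ⟨hA'.trans hB'.symm, le_antisymm ?_ hA.card_pos⟩
  rw [hA']
  exact h

theorem CliqueLink.missing_eq_of_disjoint {V : Type*} [DecidableEq V] {r : ℕ} {H : SimpleGraph V}
    {K : Finset V} {F : Finset (Finset V)} (hL : CliqueLink r H K F) {x y z x' y' z' : V}
    (h : IsExtension F K x y z) (h' : IsExtension F K x' y' z')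
    (hx : missing H K x' = missing H K x) (hy : missing H K y' = missing H K y)
    (hz : missing H K z' = missing H K z)
    (hd : Disjoint ({x, y, z} : Finset V) {x', y', z'})
    (ax : ¬ H.Adj x' x) (ay : ¬ H.Adj y' y) (az : ¬ H.Adj z' z) :
    missing H K x = missing H K y ∧ missing H K y = missing H K z ∧
      (missing H K x).card = 1 := by
  have nx := hL.missing_nonempty h
  have ny := hL.missing_nonempty h.swap_left
  have nz := hL.missing_nonempty h.swap_right.swap_left
  simp only [Finset.disjoint_left, Finset.mem_insert, Finset.mem_singleton] at hd
  have dx := hL.card_le_of_not_adj h (v := x') h'.2.2.2.1 (by grind) (by grind) (by grind)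
    (hx ▸ nx) ax
  have dy := hL.card_le_of_not_adj h.swap_left (v := y') h'.2.2.2.2.1 (by grind) (by grind)
    (by grind) (hy ▸ ny) ay
  have dz := hL.card_le_of_not_adj h.swap_right.swap_left (v := z') h'.2.2.2.2.2.1 (by grind)
    (by grind) (by grind) (hz ▸ nz) az
  rw [hx] at dx
  rw [hy] at dy
  rw [hz] at dz
  have pxy := hL.two_le_card h
  have pxz := hL.two_le_card h.swap_right
  have pyz := hL.two_le_card h.swap_left.swap_right
  have pxyz := hL.three_le_card h
  generalize missing H K x = A at *
  generalize missing H K y = B at *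
  generalize missing H K z = C at *
  have eAB := eq_of_card_union_le_one nx ny
  have eAC := eq_of_card_union_le_one nx nz
  have eBC := eq_of_card_union_le_one ny nz
  rw [Finset.union_left_comm B A C] at dy
  rw [Finset.union_comm B A] at dy
  rw [Finset.union_comm C A, Finset.union_comm C B, Finset.union_left_comm C A B,
    Finset.union_comm C B] at dz
  clear hx hy hz hd h h' hL nx ny nz ax ay az
  by_cases ab : (A ∪ B).card ≤ 1 <;> by_cases ac : (A ∪ C).card ≤ 1 <;>
    by_cases bc : (B ∪ C).card ≤ 1 <;> grind

/-- The pairs completing `v` to a triple satisfying `T`. -/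
noncomputable def pairsAt {V : Type*} [Fintype V] (T : V → V → V → Prop) (v : V) :
    Finset (V × V) :=
  open Classical in Finset.univ.filter fun q => T v q.1 q.2

theorem mem_pairsAt {V : Type*} [Fintype V] {T : V → V → V → Prop} {v : V} {q : V × V} :
    q ∈ pairsAt T v ↔ T v q.1 q.2 := by
  simp [pairsAt]

/-- The vertices completing `x`, `y` to a triple satisfying `T`. -/
noncomputable def thirds {V : Type*} [Fintype V] (T : V → V → V → Prop) (x y : V) : Finset V :=
  open Classical in Finset.univ.filter fun z => T x y z

theorem mem_thirds {V : Type*} [Fintype V] {T : V → V → V → Prop} {x y z : V} :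
    z ∈ thirds T x y ↔ T x y z := by
  simp [thirds]

theorem card_pairsAt_le {V : Type*} [Fintype V] [DecidableEq V] {T : V → V → V → Prop} {R : ℕ}
    (hR : ∀ x y, (thirds T x y).card ≤ R) (v : V) :
    (pairsAt T v).card ≤ Fintype.card V * R := by
  have : pairsAt T v ⊆ Finset.univ.biUnion fun y => (thirds T v y).image (Prod.mk y) := by
    intro q hq
    simpa [mem_thirds, Prod.ext_iff] using mem_pairsAt.1 hq
  exact (Finset.card_le_card this).trans
    (Finset.card_biUnion_le_card_mul _ _ _ fun y _ => Finset.card_image_le.trans (hR v y))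

theorem exists_fresh {V : Type*} [Fintype V] [DecidableEq V] {T : V → V → V → Prop} {R n : ℕ}
    (hR : ∀ x y, (thirds T x y).card ≤ R) (s23 : ∀ x y z, T x y z → T x z y) {v : V}
    (hv : n * (2 * R) < (pairsAt T v).card) (X : List V) (hX : X.length ≤ n) :
    ∃ y z, T v y z ∧ y ∉ X ∧ z ∉ X := by
  by_contra! h
  have hsub : pairsAt T v ⊆ X.toFinset.biUnion fun u =>
      (thirds T v u).image (fun z => (u, z)) ∪ (thirds T v u).image (fun z => (z, u)) := by
    rintro ⟨y, z⟩ hq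
    have hT := mem_pairsAt.1 hq
    have hT' := s23 _ _ _ hT
    have := h y z hT
    simp only [Finset.mem_biUnion, List.mem_toFinset, Finset.mem_union, Finset.mem_image,
      mem_thirds]
    by_cases hy : y ∈ X
    · exact ⟨y, hy, Or.inl ⟨z, hT, rfl⟩⟩
    · exact ⟨z, this hy, Or.inr ⟨y, hT', rfl⟩⟩
  have h1 := (Finset.card_le_card hsub).trans (Finset.card_biUnion_le_card_mul _ _ (2 * R)
    fun u _ => (Finset.card_union_le _ _).trans ((add_le_add
      (Finset.card_image_le.trans (hR v u)) (Finset.card_image_le.trans (hR v u))).trans_eq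
      (two_mul R).symm))
  have h2 := Nat.mul_le_mul_right (2 * R) (X.toFinset_card_le.trans hX)
  omega

theorem card_triples_meeting_le {V : Type*} [Fintype V] [DecidableEq V] {T : V → V → V → Prop}
    {D : ℕ} (s12 : ∀ x y z, T x y z → T y x z) (s23 : ∀ x y z, T x y z → T x z y)
    {X : Finset V} (hX : ∀ v ∈ X, (pairsAt T v).card ≤ D) {𝒯 : Finset (V × V × V)}
    (hT : ∀ p ∈ 𝒯, T p.1 p.2.1 p.2.2) (hm : ∀ p ∈ 𝒯, p.1 ∈ X ∨ p.2.1 ∈ X ∨ p.2.2 ∈ X) :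
    𝒯.card ≤ X.card * (3 * D) := by
  have hsub : 𝒯 ⊆ X.biUnion fun v => (pairsAt T v).image (fun q => (v, q.1, q.2)) ∪
      ((pairsAt T v).image (fun q => (q.1, v, q.2)) ∪
        (pairsAt T v).image (fun q => (q.1, q.2, v))) := by
    rintro ⟨x, y, z⟩ hp
    have h1 : T x y z := hT _ hp
    have h2 := s12 _ _ _ h1
    have h3 := s12 _ _ _ (s23 _ _ _ h1)
    have := hm _ hp
    simp only [Finset.mem_biUnion, Finset.mem_union, Finset.mem_image, mem_pairsAt]
    rcases this with h | h | h
    · exact ⟨x, h, Or.inl ⟨(y, z), h1, rfl⟩⟩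
    · exact ⟨y, h, Or.inr (Or.inl ⟨(x, z), h2, rfl⟩)⟩
    · exact ⟨z, h, Or.inr (Or.inr ⟨(x, y), h3, rfl⟩)⟩
  refine (Finset.card_le_card hsub).trans (Finset.card_biUnion_le_card_mul _ _ _ fun v hv => ?_)
  have := hX v hv
  refine (Finset.card_union_le _ _).trans ?_
  have h1 := Finset.card_union_le ((pairsAt T v).image (fun q => (q.1, v, q.2)))
    ((pairsAt T v).image (fun q => (q.1, q.2, v)))
  have h2 : ((pairsAt T v).image (fun q => (v, q.1, q.2))).card ≤ _ := Finset.card_image_le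
  have h3 : ((pairsAt T v).image (fun q => (q.1, v, q.2))).card ≤ _ := Finset.card_image_le
  have h4 : ((pairsAt T v).image (fun q => (q.1, q.2, v))).card ≤ _ := Finset.card_image_le
  omega

/-- The vertex set of an ordered triple. -/
def tripleSupport {V : Type*} [DecidableEq V] (p : V × V × V) : Finset V := {p.1, p.2.1, p.2.2}

theorem exists_disjoint_triples {V : Type*} [Fintype V] [DecidableEq V] {T : V → V → V → Prop}
    {D N : ℕ} (s12 : ∀ x y z, T x y z → T y x z) (s23 : ∀ x y z, T x y z → T x z y)
    (hD : ∀ v, (pairsAt T v).card ≤ D) {𝒯 : Finset (V × V × V)}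
    (hT : ∀ p ∈ 𝒯, T p.1 p.2.1 p.2.2) (hN : 3 * N * (3 * D) < 𝒯.card) (n : ℕ) (hn : n ≤ N) :
    ∃ 𝒟 ⊆ 𝒯, 𝒟.card = n ∧
      ∀ p ∈ 𝒟, ∀ q ∈ 𝒟, p ≠ q → Disjoint (tripleSupport p) (tripleSupport q) := by
  induction n with
  | zero => exact ⟨∅, by simp⟩
  | succ n ih =>
    obtain ⟨𝒟, h𝒟, hc, hd⟩ := ih (by omega)
    obtain ⟨p, hp, hpd⟩ : ∃ p ∈ 𝒯, Disjoint (tripleSupport p) (𝒟.biUnion tripleSupport) := by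
      by_contra! h
      have h1 := card_triples_meeting_le s12 s23 (X := 𝒟.biUnion tripleSupport)
        (fun v _ => hD v) hT (fun p hp => by
          have := h p hp
          rw [Finset.not_disjoint_iff] at this
          obtain ⟨a, ha, ha'⟩ := this
          simp only [tripleSupport, Finset.mem_insert, Finset.mem_singleton] at ha
          rcases ha with rfl | rfl | rfl <;> simp only [ha', true_or, or_true])
      have h2 : (𝒟.biUnion tripleSupport).card ≤ 𝒟.card * 3 :=
        Finset.card_biUnion_le_card_mul _ _ _ fun p _ => Finset.card_le_three
      have h3 : 𝒟.card * 3 ≤ 3 * N := by omega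
      have h4 := Nat.mul_le_mul_right (3 * D) (h2.trans h3)
      omega
    rw [Finset.disjoint_biUnion_right] at hpd
    have hpn : p ∉ 𝒟 := by
      intro hmem
      have := hpd p hmem
      simp [tripleSupport] at this
    refine ⟨insert p 𝒟, Finset.insert_subset hp h𝒟, by
      rw [Finset.card_insert_of_notMem hpn, hc], ?_⟩
    intro q hq q' hq' hne
    rw [Finset.mem_insert] at hq hq'
    rcases hq with rfl | hq <;> rcases hq' with rfl | hq'
    · exact absurd rfl hne
    · exact hpd _ hq'
    · exact (hpd _ hq).symm
    · exact hd _ hq _ hq' hne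

/-- Three-colour Ramsey theorem: a large set contains a pair avoided by all three graphs, or a
large clique in one of them. -/
theorem exists_nonadj_or_isNClique {ι : Type*} (G : Fin 3 → SimpleGraph ι) (n : ℕ)
    (a : Fin 3 → ℕ) (ha : ∑ i, a i = n) (s : Finset ι) (hs : 3 ^ n ≤ s.card) :
    (∃ p ∈ s, ∃ q ∈ s, p ≠ q ∧ ∀ i, ¬ (G i).Adj p q) ∨
      ∃ i, ∃ t ⊆ s, (G i).IsNClique (a i) t := by
  classical
  induction n generalizing a s with
  | zero =>
    have : a 0 = 0 := (Finset.sum_eq_zero_iff.1 ha) 0 (Finset.mem_univ _)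
    exact Or.inr ⟨0, ∅, by simp, by simp [isNClique_iff, this]⟩
  | succ n ih =>
    by_cases hpos : ∃ i, a i = 0
    · obtain ⟨i, hi⟩ := hpos
      exact Or.inr ⟨i, ∅, by simp, by simp [isNClique_iff, hi]⟩
    push Not at hpos
    have h3 : 0 < 3 ^ n := by positivity
    rw [pow_succ] at hs
    obtain ⟨v, hv⟩ := Finset.card_pos.1 (by omega : 0 < s.card)
    by_cases hcov : ∃ q ∈ s, v ≠ q ∧ ∀ i, ¬ (G i).Adj v q
    · exact Or.inl ⟨v, hv, hcov⟩
    push Not at hcov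
    have hsub : s.erase v ⊆ Finset.univ.biUnion fun i => s.filter ((G i).Adj v) := by
      intro q hq
      rw [Finset.mem_erase] at hq
      obtain ⟨i, hi⟩ := hcov q hq.2 hq.1.symm
      simp only [Finset.mem_biUnion, Finset.mem_filter, Finset.mem_univ, true_and]
      exact ⟨i, hq.2, hi⟩
    obtain ⟨i, hi⟩ : ∃ i, 3 ^ n ≤ (s.filter ((G i).Adj v)).card := by
      by_contra! h
      have h1 := (Finset.card_le_card hsub).trans (Finset.card_biUnion_le_card_mul _ _ (3 ^ n - 1)
        fun i _ => by have := h i; omega)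
      rw [Finset.card_erase_of_mem hv, Finset.card_univ, Fintype.card_fin] at h1
      omega
    have hsum : ∑ j, Function.update a i (a i - 1) j = n := by
      have h1 := Finset.sum_update_of_mem (Finset.mem_univ i) a (a i - 1)
      have h2 := Finset.add_sum_erase Finset.univ a (Finset.mem_univ i)
      have h4 := hpos i
      rw [Finset.sdiff_singleton_eq_erase] at h1
      omega
    rcases ih _ hsum _ hi with ⟨p, hp, q, hq, h⟩ | ⟨j, t, ht, hc⟩
    · exact Or.inl ⟨p, (Finset.mem_filter.1 hp).1, q, (Finset.mem_filter.1 hq).1, h⟩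
    right
    by_cases hij : j = i
    · subst hij
      rw [Function.update_self] at hc
      refine ⟨j, insert v t, Finset.insert_subset hv (ht.trans (Finset.filter_subset _ _)), ?_⟩
      have h1 := hc.insert fun b hb => (Finset.mem_filter.1 (ht hb)).2
      rwa [Nat.sub_add_cancel (Nat.pos_of_ne_zero (hpos j))] at h1
    · rw [Function.update_of_ne hij] at hc
      exact ⟨j, t, ht.trans (Finset.filter_subset _ _), hc⟩

theorem SimpleGraph.CliqueFree.not_isNClique_comap {V W : Type*} [DecidableEq W]
    {H : SimpleGraph W} {r : ℕ} (h : H.CliqueFree r) (f : V → W) (t : Finset V) :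
    ¬ (H.comap f).IsNClique r t := by
  intro ht
  have hadj : ∀ p ∈ t, ∀ q ∈ t, p ≠ q → H.Adj (f p) (f q) :=
    fun p hp q hq hne => ht.isClique hp hq hne
  refine h (t.image f) ⟨?_, ?_⟩
  · intro u hu w hw hne
    simp only [Finset.coe_image, Set.mem_image, Finset.mem_coe] at hu hw
    obtain ⟨p, hp, rfl⟩ := hu
    obtain ⟨q, hq, rfl⟩ := hw
    exact hadj p hp q hq fun h => hne (congrArg f h)
  · rw [Finset.card_image_of_injOn, ht.card_eq]
    intro p hp q hq hpq
    by_contra hne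
    exact (hadj p hp q hq hne).ne hpq

namespace CliqueLink

variable {V : Type*} [Fintype V] [DecidableEq V] {r : ℕ} {H : SimpleGraph V} {K : Finset V}
  {F : Finset (Finset V)} {A B C : Finset V} {𝒯 : Finset (V × V × V)}

theorem card_thirds_le (hL : CliqueLink r H K F) {T : V → V → V → Prop}
    (hT : ∀ x y z, T x y z → IsExtension F K x y z) (x y : V) : (thirds T x y).card ≤ r := by
  have hcl : H.IsClique (thirds T x y : Finset V) := fun z hz z' hz' hne =>
    hL.eq_or_adj (hT _ _ _ (mem_thirds.1 hz)) (hT _ _ _ (mem_thirds.1 hz')) hne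
  by_contra! h
  obtain ⟨Q, hQ, hc⟩ := Finset.exists_subset_card_eq h.le
  exact hL.cliqueFree Q ⟨hcl.subset (by exact_mod_cast hQ), hc⟩

theorem card_triples_le_of_missing_ne (hL : CliqueLink r H K F)
    (hT : ∀ p ∈ 𝒯, IsExtension F K p.1 p.2.1 p.2.2 ∧ missing H K p.1 = A ∧
      missing H K p.2.1 = B ∧ missing H K p.2.2 = C)
    (hne : ¬ (A = B ∧ B = C ∧ A.card = 1)) :
    𝒯.card ≤ 3 * 3 ^ (3 * r) * (3 * (Fintype.card V * r)) := by
  by_contra! h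
  obtain ⟨𝒟, h𝒟, hc, hd⟩ := exists_disjoint_triples (T := IsExtension F K)
    (fun _ _ _ => IsExtension.swap_left) (fun _ _ _ => IsExtension.swap_right)
    (fun v => card_pairsAt_le (hL.card_thirds_le fun _ _ _ => id) v)
    (fun p hp => (hT p hp).1) h _ le_rfl
  rcases exists_nonadj_or_isNClique
      ![H.comap fun p : V × V × V => p.1, H.comap fun p : V × V × V => p.2.1,
        H.comap fun p : V × V × V => p.2.2]
      (3 * r) (fun _ => r) (by simp) 𝒟 hc.ge with ⟨p, hp, q, hq, hpq, hadj⟩ | ⟨i, t, -, ht⟩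
  · obtain ⟨hpE, rfl, rfl, rfl⟩ := hT p (h𝒟 hp)
    obtain ⟨hqE, h1, h2, h3⟩ := hT q (h𝒟 hq)
    exact hne (hL.missing_eq_of_disjoint hpE hqE h1 h2 h3 (hd p hp q hq hpq)
      (fun h => hadj 0 h.symm) (fun h => hadj 1 h.symm) (fun h => hadj 2 h.symm))
  · fin_cases i <;> exact hL.cliqueFree.not_isNClique_comap _ _ ht

theorem card_triples_le_of_card_missing_eq_one (hL : CliqueLink r H K F)
    (hT : ∀ p ∈ 𝒯, IsExtension F K p.1 p.2.1 p.2.2 ∧ missing H K p.1 = A ∧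
      missing H K p.2.1 = A ∧ missing H K p.2.2 = A)
    (hA : A.card = 1) :
    𝒯.card ≤ Fintype.card V * (3 * (7 * (2 * r))) := by
  let T x y z := IsExtension F K x y z ∧ missing H K x = A ∧ missing H K y = A ∧
    missing H K z = A
  let W v := v ∉ K ∧ missing H K v = A
  have s12 : ∀ x y z, T x y z → T y x z := fun x y z h =>
    ⟨h.1.swap_left, h.2.2.1, h.2.1, h.2.2.2⟩
  have s23 : ∀ x y z, T x y z → T x z y := fun x y z h =>
    ⟨h.1.swap_right, h.2.1, h.2.2.2, h.2.2.1⟩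
  have hW : ∀ x y z, T x y z → W x := fun x y z h => ⟨h.1.2.2.2.1, h.2.1⟩
  have tri : ∀ u v w, W u → W v → W w → H.Adj u v → H.Adj v w → ¬ H.Adj u w := by
    intro u v w hu hv hw huv hvw huw
    have := hL.card_lt_of_isClique (Q := {u, v, w}) (by simp [huv, hvw, huw])
      (by simp [hu.1, hv.1, hw.1])
    rw [Finset.card_eq_three.2 ⟨u, v, w, huv.ne, huw.ne, hvw.ne, rfl⟩] at this
    simp [hu.2, hv.2, hw.2, hA] at this
  have ind : ∀ x y z, T x y z → ¬ H.Adj x y := by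
    intro x y z h hxy
    have := hL.two_le_card h.1 hxy
    simp [h.2.1, h.2.2.1, hA] at this
  have dom : ∀ x y z v, T x y z → W v → v ≠ x → v ≠ y → v ≠ z →
      H.Adj v x ∨ H.Adj v y ∨ H.Adj v z := by
    intro x y z v h hv hx hy hz
    obtain ⟨P, hP, -, hadj, hc⟩ := hL.exists_dominating_clique h.1 hv.1 hx hy hz
    have hP0 : P.Nonempty := by
      rw [← Finset.card_pos]
      have := Finset.card_le_card
        (Finset.subset_union_left (s₁ := missing H K v) (s₂ := P.biUnion (missing H K)))
      rw [hv.2, hA] at this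
      rw [hv.2] at hc
      omega
    obtain ⟨p, hp⟩ := hP0
    have hpx := hP hp
    simp only [Finset.mem_insert, Finset.mem_singleton] at hpx
    rcases hpx with rfl | rfl | rfl
    · exact Or.inl (hadj _ hp)
    · exact Or.inr (Or.inl (hadj _ hp))
    · exact Or.inr (Or.inr (hadj _ hp))
  have hR := hL.card_thirds_le (T := T) fun _ _ _ h => h.1
  have hm := card_triples_meeting_le s12 s23 (D := 7 * (2 * r))
    (X := Finset.univ.filter fun v => (pairsAt T v).card ≤ 7 * (2 * r))
    (fun v hv => (Finset.mem_filter.1 hv).2) (𝒯 := 𝒯) hT ?_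
  · exact hm.trans (Nat.mul_le_mul_right _ (Finset.card_filter_le _ _))
  · intro p hp
    simp only [Finset.mem_filter, Finset.mem_univ, true_and]
    by_contra! h
    exact exists_vertex_not_fresh hW s12 s23 tri ind (fun x y z h => h.1.1) dom (hT p hp)
      (exists_fresh hR s23 h.1) (exists_fresh hR s23 h.2.1) (exists_fresh hR s23 h.2.2)

theorem card_triples_le (hL : CliqueLink r H K F)
    (hT : ∀ p ∈ 𝒯, IsExtension F K p.1 p.2.1 p.2.2 ∧ missing H K p.1 = A ∧
      missing H K p.2.1 = B ∧ missing H K p.2.2 = C) :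
    𝒯.card ≤ (9 * 3 ^ (3 * r) * r + 42 * r) * Fintype.card V := by
  by_cases h : A = B ∧ B = C ∧ A.card = 1
  · obtain ⟨rfl, rfl, hA⟩ := h
    have := hL.card_triples_le_of_card_missing_eq_one hT hA
    nlinarith [Nat.zero_le (9 * 3 ^ (3 * r) * r * Fintype.card V)]
  · have := hL.card_triples_le_of_missing_ne hT h
    nlinarith [Nat.zero_le (42 * r * Fintype.card V)]

end CliqueLink

theorem not_cliqueFree_induce_iff {V : Type*} {H : SimpleGraph V} {S : Finset V} {n : ℕ} :
    ¬ (H.induce (S : Set V)).CliqueFree n ↔ ∃ Q ⊆ S, H.IsNClique n Q := by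
  rw [cliqueFree_induce_iff, CliqueFreeOn]
  push Not
  simp only [Finset.coe_subset]

theorem IsRTSystem.cliqueLink {V : Type*} [DecidableEq V] {r t : ℕ} {H : SimpleGraph V}
    {F : Finset (Finset V)} (h : IsRTSystem r t H F) (hr : 3 ≤ r) {K : Finset V}
    (hK : H.IsNClique (r - 2) K) : CliqueLink r H K F where
  three_le := hr
  cliqueFree := h.1
  isNClique := hK
  not_isNClique S hS Q hQ hc := not_cliqueFree_induce_iff.2 ⟨Q, hQ, hc⟩ (h.2.1 S hS).2.1
  exists_isNClique S hS v hv := not_cliqueFree_induce_iff.1 ((h.2.1 S hS).2.2 v hv)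

theorem IsRTSystem.card_le {V : Type*} [Fintype V] [DecidableEq V] {r : ℕ} {H : SimpleGraph V}
    {F : Finset (Finset V)} (h : IsRTSystem r (r + 1) H F) (hr : 3 ≤ r) :
    F.card ≤ (1 + (2 ^ (r + 1)) ^ 4 * (9 * 3 ^ (3 * r) * r + 42 * r)) * Fintype.card V := by
  classical
  rcases F.eq_empty_or_nonempty with rfl | ⟨S₀, hS₀⟩
  · simp
  have hc₀ := (h.2.1 S₀ hS₀).1
  let I := S₀.powerset ×ˢ S₀.powerset ×ˢ S₀.powerset ×ˢ S₀.powerset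
  let 𝒯 (i : Finset V × Finset V × Finset V × Finset V) : Finset (V × V × V) :=
    Finset.univ.filter fun p => H.IsNClique (r - 2) i.1 ∧ IsExtension F i.1 p.1 p.2.1 p.2.2 ∧
      missing H i.1 p.1 = i.2.1 ∧ missing H i.1 p.2.1 = i.2.2.1 ∧ missing H i.1 p.2.2 = i.2.2.2
  have hI : I.card = (2 ^ (r + 1)) ^ 4 := by
    simp only [I, Finset.card_product, Finset.card_powerset, hc₀]
    ring
  have hsub : F ⊆ insert S₀ (I.biUnion fun i =>
      (𝒯 i).image fun p => ({p.1, p.2.1, p.2.2} ∪ i.1 : Finset V)) := by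
    intro S hS
    rw [Finset.mem_insert, or_iff_not_imp_left]
    intro hne
    obtain ⟨K, hK, hcl⟩ := not_cliqueFree_induce_iff.1 (h.2.2 S hS S₀ hS₀ hne)
    have hKS := hK.trans Finset.inter_subset_left
    have hKS₀ := hK.trans Finset.inter_subset_right
    have h3 : (S \ K).card = 3 := by
      rw [Finset.card_sdiff_of_subset hKS, (h.2.1 S hS).1, hcl.card_eq]
      omega
    obtain ⟨x, y, z, hxy, hxz, hyz, he⟩ := Finset.card_eq_three.1 h3
    have hmem : ∀ v ∈ S \ K, v ∉ K := fun v hv => (Finset.mem_sdiff.1 hv).2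
    have hU : ({x, y, z} ∪ K : Finset V) = S := by
      rw [← he, Finset.sdiff_union_of_subset hKS]
    have hM : ∀ v, missing H K v ⊆ S₀ := fun v k hk => hKS₀ (mem_missing.1 hk).1
    rw [Finset.mem_biUnion]
    refine ⟨(K, missing H K x, missing H K y, missing H K z), ?_,
      Finset.mem_image.2 ⟨(x, y, z), ?_, hU⟩⟩
    · simp [I, hKS₀, hM]
    · simp only [𝒯, Finset.mem_filter, Finset.mem_univ, true_and, and_true]
      exact ⟨hcl, hxy, hxz, hyz, hmem _ (by simp [he]), hmem _ (by simp [he]),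
        hmem _ (by simp [he]), hU ▸ hS⟩
  have hbound : ∀ i ∈ I, ((𝒯 i).image fun p => ({p.1, p.2.1, p.2.2} ∪ i.1 : Finset V)).card ≤
      (9 * 3 ^ (3 * r) * r + 42 * r) * Fintype.card V := by
    intro i _
    refine Finset.card_image_le.trans ?_
    by_cases hK : H.IsNClique (r - 2) i.1
    · exact (h.cliqueLink hr hK).card_triples_le fun p hp => (Finset.mem_filter.1 hp).2.2
    · simp [𝒯, hK]
  have hle := (Finset.card_le_card hsub).trans ((Finset.card_insert_le _ _).trans
    (Nat.add_le_add_right (Finset.card_biUnion_le_card_mul _ _ _ hbound) 1))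
  rw [hI] at hle
  have hV : 1 ≤ Fintype.card V := by
    have := S₀.card_le_univ
    omega
  calc F.card ≤ _ := hle
    _ ≤ (2 ^ (r + 1)) ^ 4 * ((9 * 3 ^ (3 * r) * r + 42 * r) * Fintype.card V) +
        Fintype.card V := Nat.add_le_add_left hV _
    _ = _ := by ring

theorem SimpleGraph.IsNClique.le_of_coloring {V : Type*} {H : SimpleGraph V} {Q : Finset V}
    {k n : ℕ} (hQ : H.IsNClique k Q) (f : V → ℕ) (hf : ∀ v ∈ Q, f v < n)
    (hadj : ∀ u ∈ Q, ∀ v ∈ Q, H.Adj u v → f u ≠ f v) : k ≤ n := by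
  rw [← hQ.card_eq, ← Finset.card_range n]
  refine Finset.card_le_card_of_injOn f (fun v hv => by simpa using hf v hv) ?_
  intro u hu v hv huv
  by_contra hne
  exact hadj u hu v hv (hQ.isClique hu hv hne) huv

/-- The join of a clique on `{v | v < s}` with the disjoint union of the two vertices `s`, `s + 1`
and the graph on the vertices `s + 2 + j` in which `2 * i` and `2 * k + 1` are adjacent for
`i ≠ k`. -/
def cocktailGraph (s m : ℕ) : SimpleGraph (Fin m) where
  Adj u v := u ≠ v ∧ (u.1 < s ∨ v.1 < s ∨ (s + 2 ≤ u.1 ∧ s + 2 ≤ v.1 ∧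
    (u.1 - (s + 2)) % 2 ≠ (v.1 - (s + 2)) % 2 ∧ (u.1 - (s + 2)) / 2 ≠ (v.1 - (s + 2)) / 2))
  symm := ⟨fun u v h => ⟨h.1.symm, by
    rcases h.2 with h | h | h
    · exact Or.inr (Or.inl h)
    · exact Or.inl h
    · exact Or.inr (Or.inr ⟨h.2.1, h.1, h.2.2.1.symm, h.2.2.2.symm⟩)⟩⟩
  loopless := ⟨fun u h => h.1 rfl⟩

/-- The first `s + 2` vertices together with the `i`-th pair of later vertices. -/
def cocktailSet (s m i : ℕ) : Finset (Fin m) :=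
  Finset.univ.filter fun v => v.1 < s + 2 ∨ v.1 = s + 2 + 2 * i ∨ v.1 = s + 2 + 2 * i + 1

theorem mem_cocktailSet {s m i : ℕ} {v : Fin m} : v ∈ cocktailSet s m i ↔
    v.1 < s + 2 ∨ v.1 = s + 2 + 2 * i ∨ v.1 = s + 2 + 2 * i + 1 := by
  simp [cocktailSet]

theorem card_cocktailSet {s m i : ℕ} (h : s + 2 + 2 * i + 1 < m) :
    (cocktailSet s m i).card = s + 4 := by
  have : (cocktailSet s m i).map Fin.valEmbedding =
      insert (s + 2 + 2 * i) (insert (s + 2 + 2 * i + 1) (Finset.range (s + 2))) := by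
    ext v
    simp only [Finset.mem_map, mem_cocktailSet, Fin.valEmbedding_apply, Finset.mem_insert,
      Finset.mem_range]
    constructor
    · rintro ⟨v, hv, rfl⟩
      omega
    · intro hv
      exact ⟨⟨v, by omega⟩, by simp only; omega, rfl⟩
  rw [← Finset.card_map Fin.valEmbedding, this, Finset.card_insert_of_notMem,
    Finset.card_insert_of_notMem, Finset.card_range]
  · rw [Finset.mem_range]
    omega
  · rw [Finset.mem_insert, Finset.mem_range]
    omega

theorem cocktailGraph_cliqueFree (s m : ℕ) : (cocktailGraph s m).CliqueFree (s + 3) := by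
  intro Q hQ
  have := hQ.le_of_coloring (n := s + 2)
    (fun v => if v.1 < s then v.1 else if v.1 < s + 2 then s else s + (v.1 - (s + 2)) % 2)
    (fun v _ => by split_ifs <;> omega)
    (fun u _ v _ h => by
      obtain ⟨h1, h2⟩ := h
      rw [ne_eq, Fin.ext_iff] at h1
      split_ifs <;> omega)
  omega

theorem isNClique_Iic_cocktailGraph {s m : ℕ} (h : s < m) :
    (cocktailGraph s m).IsNClique (s + 1) (Finset.Iic ⟨s, h⟩) := by
  refine ⟨fun u hu v hv hne => ⟨hne, ?_⟩, by simp⟩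
  simp only [Finset.coe_Iic, Set.mem_Iic, Fin.le_def] at hu hv
  rw [ne_eq, Fin.ext_iff] at hne
  omega

theorem isRTSystem_cocktail (s m : ℕ) :
    IsRTSystem (s + 3) (s + 3 + 1) (cocktailGraph s m)
      ((Finset.range ((m - (s + 2)) / 2)).image (cocktailSet s m)) := by
  have hlt : ∀ i ∈ Finset.range ((m - (s + 2)) / 2), s + 2 + 2 * i + 1 < m := by
    intro i hi
    rw [Finset.mem_range] at hi
    omega
  refine ⟨cocktailGraph_cliqueFree s m, ?_, ?_⟩
  · intro S hS
    obtain ⟨i, hi, rfl⟩ := Finset.mem_image.1 hS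
    have hm := hlt i hi
    refine ⟨card_cocktailSet hm, ?_, ?_⟩
    · by_contra hc
      obtain ⟨Q, hQ, hcl⟩ := not_cliqueFree_induce_iff.1 hc
      have := hcl.le_of_coloring (n := s + 1) (fun v => if v.1 < s then v.1 else s)
        (fun v _ => by split_ifs <;> omega)
        (fun u hu v hv h => by
          obtain ⟨h1, h2⟩ := h
          have hu' := mem_cocktailSet.1 (hQ hu)
          have hv' := mem_cocktailSet.1 (hQ hv)
          rw [ne_eq, Fin.ext_iff] at h1
          split_ifs <;> omega)
      omega
    · intro v hv
      rw [mem_cocktailSet] at hv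
      obtain ⟨w, hw, hwv, hwi⟩ : ∃ w : Fin m, s + 2 ≤ w.1 ∧
          (v.1 - (s + 2)) % 2 ≠ (w.1 - (s + 2)) % 2 ∧ (w.1 - (s + 2)) / 2 = i := by
        refine ⟨⟨s + 2 + 2 * i + (1 - (v.1 - (s + 2)) % 2), by omega⟩, ?_⟩
        simp only
        omega
      refine not_cliqueFree_induce_iff.2
        ⟨insert v (insert w (Finset.Iio ⟨s, by omega⟩)), ?_, ?_, ?_⟩
      · refine Finset.insert_subset_insert _ fun u hu => mem_cocktailSet.2 ?_
        simp only [Finset.mem_insert, Finset.mem_Iio, Fin.lt_def] at hu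
        rcases hu with rfl | hu <;> omega
      · intro a ha b hb hne
        refine ⟨hne, ?_⟩
        simp only [Finset.coe_insert, Finset.coe_Iio, Set.mem_insert_iff, Set.mem_Iio,
          Fin.lt_def] at ha hb
        rw [ne_eq, Fin.ext_iff] at hne
        rcases ha with rfl | rfl | ha <;> rcases hb with rfl | rfl | hb <;> omega
      · rw [Finset.card_insert_of_notMem, Finset.card_insert_of_notMem]
        · simp
        · simp only [Finset.mem_Iio, Fin.lt_def]
          omega
        · simp only [Finset.mem_insert, Finset.mem_Iio, Fin.lt_def, Fin.ext_iff]
          omega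
  · intro S hS T hT _
    obtain ⟨i, hi, rfl⟩ := Finset.mem_image.1 hS
    obtain ⟨j, -, rfl⟩ := Finset.mem_image.1 hT
    have := hlt i hi
    have hm : s < m := by omega
    refine not_cliqueFree_induce_iff.2 ⟨_, ?_, isNClique_Iic_cocktailGraph hm⟩
    intro u hu
    simp only [Finset.mem_Iic, Fin.le_def] at hu
    rw [Finset.mem_inter, mem_cocktailSet, mem_cocktailSet]
    omega

theorem card_image_cocktailSet (s m : ℕ) :
    ((Finset.range ((m - (s + 2)) / 2)).image (cocktailSet s m)).card = (m - (s + 2)) / 2 := by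
  rw [Finset.card_image_of_injOn, Finset.card_range]
  intro i hi j hj hij
  simp only [Finset.coe_range, Set.mem_Iio] at hi hj
  have hmem : (⟨s + 2 + 2 * i, by omega⟩ : Fin m) ∈ cocktailSet s m i :=
    mem_cocktailSet.2 (by simp)
  have := mem_cocktailSet.1 (show _ ∈ cocktailSet s m j from hij ▸ hmem)
  simp only at this
  omega

/-- For `r ≥ 3`: `s_{r,r+1}(m) = Θ(m)`. -/
theorem stmt8 (r : ℕ) (hr : 3 ≤ r) :
    ∃ c C : ℝ, 0 < c ∧ 0 < C ∧ ∃ M : ℕ,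
      (∀ (V : Type) [Fintype V] [DecidableEq V] (H : SimpleGraph V) (F : Finset (Finset V)),
        IsRTSystem r (r + 1) H F → (F.card : ℝ) ≤ C * (Fintype.card V : ℝ)) ∧
      (∀ m : ℕ, M ≤ m → ∃ (H : SimpleGraph (Fin m)) (F : Finset (Finset (Fin m))),
        IsRTSystem r (r + 1) H F ∧ c * (m : ℝ) ≤ (F.card : ℝ)) := by
  refine ⟨1 / 4, ((1 + (2 ^ (r + 1)) ^ 4 * (9 * 3 ^ (3 * r) * r + 42 * r) : ℕ) : ℝ), by norm_num,
    by positivity, 2 * r, fun V _ _ H F h => by exact_mod_cast h.card_le hr, fun m hm => ?_⟩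
  obtain ⟨s, rfl⟩ := Nat.exists_eq_add_of_le' hr
  refine ⟨_, _, isRTSystem_cocktail s m, ?_⟩
  rw [card_image_cocktailSet]
  have : m ≤ 4 * ((m - (s + 2)) / 2) := by omega
  have : (m : ℝ) ≤ 4 * ((m - (s + 2)) / 2 : ℕ) := by exact_mod_cast this
  linarith
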